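/- Let K ≥ 0 be an integer and u ∈ C^{K+2}(ℝ³;ℝ³) with bounded derivatives, ω = ∇×u. For every 0 ≤ k ≤ N−1 the following bounds hold: |D^K_{C_k} ∇_{C_k} Γ[u,C]| ≤ c(K) |C_{k+1} − C_{k-1}| (1 + |C_k − C_{k-1}|) ‖ω‖_{C^{K+1}}; |D_{C_{k+1}} ∇_{C_k} Γ[u,C]| ≤ c (1 + |C_{k+1} − C_{k-1}|)(1 + |C_k − C_{k-1}|) ‖ω‖_{C²}; and |D_{C_{k-1}} ∇_{C_k} Γ[u,C]| ≤ c (1 + |C_{k+1} − C_{k-1}|)(1 + |C_{k+1} − C_k|) ‖ω‖_{C²}, where c and c(K) are universal constants (c(K) depending only on K). -/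

import Mathlib

noncomputable section

open scoped RealInnerProductSpace BigOperators
open MeasureTheory

/-- ℝ³ as a Euclidean space. -/
abbrev E3 : Type := EuclideanSpace ℝ (Fin 3)

/-- The vector of `E3` with the three given coordinates. -/
def vec3 (a b c : ℝ) : E3 := (WithLp.equiv 2 (Fin 3 → ℝ)).symm ![a, b, c]

/-- Cross product on `E3`. -/
def cross3 (v w : E3) : E3 :=
  vec3 (v 1 * w 2 - v 2 * w 1) (v 2 * w 0 - v 0 * w 2) (v 0 * w 1 - v 1 * w 0)

/-- `j`-th standard basis vector of `E3`. -/
def e3 (j : Fin 3) : E3 := EuclideanSpace.single j 1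

/-- Curl (vorticity) of a vector field on `E3`. -/
def curl3 (u : E3 → E3) (x : E3) : E3 :=
  vec3 (fderiv ℝ u x (e3 1) 2 - fderiv ℝ u x (e3 2) 1)
       (fderiv ℝ u x (e3 2) 0 - fderiv ℝ u x (e3 0) 2)
       (fderiv ℝ u x (e3 0) 1 - fderiv ℝ u x (e3 1) 0)

/-- Divergence of a vector field on `E3`. -/
def div3 (u : E3 → E3) (x : E3) : ℝ := ∑ j : Fin 3, fderiv ℝ u x (e3 j) j

/-- Componentwise Laplacian of a vector field on `E3`. -/
def lap3 (u : E3 → E3) (x : E3) : E3 :=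
  ∑ j : Fin 3, fderiv ℝ (fun y => fderiv ℝ u y (e3 j)) x (e3 j)

/-- Transposed Jacobian of `ω` at `x`, applied to `v`:  `((Dω)ᵀ v)_j = ∑_i ∂_j ω_i v_i`. -/
def jacT (ω : E3 → E3) (x v : E3) : E3 :=
  (WithLp.equiv 2 (Fin 3 → ℝ)).symm fun j => ⟪fderiv ℝ ω x (e3 j), v⟫

/-- Sup norm of the `j`-th derivative of a vector field. -/
def supDeriv (j : ℕ) (u : E3 → E3) : ℝ := ⨆ x : E3, ‖iteratedFDeriv ℝ j u x‖

/-- `C^m` norm: maximum of the sup norms of the derivatives of order `≤ m`. -/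
def cNorm (m : ℕ) (u : E3 → E3) : ℝ :=
  (Finset.range (m + 1)).sup' (Finset.nonempty_range_iff.mpr (Nat.succ_ne_zero m))
    fun j => supDeriv j u

/-- Sobolev `H^K` norm. -/
def sobNorm (K : ℕ) (u : E3 → E3) : ℝ :=
  Real.sqrt (∑ j ∈ Finset.range (K + 1), ∫ x : E3, ‖iteratedFDeriv ℝ j u x‖ ^ 2)

/-- Circulation of `u` along the closed polygon with vertices `C 0, …, C (N-1)`. -/
def circulation (N : ℕ) [NeZero N] (u : E3 → E3) (C : Fin N → E3) : ℝ :=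
  ∑ k : Fin N, ∫ a in (0:ℝ)..(1:ℝ), ⟪u ((1 - a) • C k + a • C (k + 1)), C (k + 1) - C k⟫

/-- `⟨ω⟩` : average of `ω` along the segment joining `(xm+xp)/2` to `y`. -/
def segAvg (ω : E3 → E3) (xm y xp : E3) : E3 :=
  ∫ a in (0:ℝ)..(1:ℝ), ω (a • y + (1 - a) • ((2:ℝ)⁻¹ • (xm + xp)))

variable {N : ℕ}

/-- Partial derivative of a real functional of the vertices with respect to
the `j`-th coordinate of the vertex `k`. -/
def vpdR (k : Fin N) (j : Fin 3) (F : (Fin N → E3) → ℝ) (C : Fin N → E3) : ℝ :=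
  fderiv ℝ (fun x => F (Function.update C k x)) (C k) (e3 j)

/-- Gradient of a real functional of the vertices with respect to the vertex `k`. -/
def vgradR (k : Fin N) (F : (Fin N → E3) → ℝ) (C : Fin N → E3) : E3 :=
  gradient (fun x => F (Function.update C k x)) (C k)

/-- `∇_{C_a} × ∇_{C_b}` applied to a real functional of the vertices. -/
def gradCross (a b : Fin N) (F : (Fin N → E3) → ℝ) (C : Fin N → E3) : E3 :=
  vec3 (vpdR a 1 (vpdR b 2 F) C - vpdR a 2 (vpdR b 1 F) C)
       (vpdR a 2 (vpdR b 0 F) C - vpdR a 0 (vpdR b 2 F) C)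
       (vpdR a 0 (vpdR b 1 F) C - vpdR a 1 (vpdR b 0 F) C)

/-- Migdal's area derivative `(∑_{j>k} ∇_{C_j} + ½ ∇_{C_k}) × ∇_{C_k}` on real functionals. -/
def gradCrossM (k : Fin N) (F : (Fin N → E3) → ℝ) (C : Fin N → E3) : E3 :=
  (∑ j ∈ Finset.univ.filter (fun j : Fin N => (k : ℕ) < (j : ℕ)), gradCross j k F C)
    + (2:ℝ)⁻¹ • gradCross k k F C

/-- Partial derivative of a complex functional of the vertices. -/
def vpd (k : Fin N) (j : Fin 3) (F : (Fin N → E3) → ℂ) (C : Fin N → E3) : ℂ :=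
  fderiv ℝ (fun x => F (Function.update C k x)) (C k) (e3 j)

/-- `∇_{C_a} × ∇_{C_b}` on complex functionals. -/
def opCross (a b : Fin N) (F : (Fin N → E3) → ℂ) (C : Fin N → E3) : Fin 3 → ℂ :=
  ![vpd a 1 (vpd b 2 F) C - vpd a 2 (vpd b 1 F) C,
    vpd a 2 (vpd b 0 F) C - vpd a 0 (vpd b 2 F) C,
    vpd a 0 (vpd b 1 F) C - vpd a 1 (vpd b 0 F) C]

/-- `∇_{C_k} ×` applied to a `ℂ³`-valued functional of the vertices. -/
def vcurl (k : Fin N) (G : (Fin N → E3) → Fin 3 → ℂ) (C : Fin N → E3) : Fin 3 → ℂ :=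
  ![vpd k 1 (fun D => G D 2) C - vpd k 2 (fun D => G D 1) C,
    vpd k 2 (fun D => G D 0) C - vpd k 0 (fun D => G D 2) C,
    vpd k 0 (fun D => G D 1) C - vpd k 1 (fun D => G D 0) C]

/-- Embedding of a real vector into `ℂ³`. -/
def toC3 (v : E3) : Fin 3 → ℂ := fun j => (v j : ℂ)

/-- Bilinear (non-hermitian) dot product on `ℂ³`. -/
def cdot (v w : Fin 3 → ℂ) : ℂ := ∑ j : Fin 3, v j * w j

/-- Bilinear cross product on `ℂ³`. -/
def ccross3 (v w : Fin 3 → ℂ) : Fin 3 → ℂ :=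
  ![v 1 * w 2 - v 2 * w 1, v 2 * w 0 - v 0 * w 2, v 0 * w 1 - v 1 * w 0]

/-- Euclidean magnitude of a vector of `ℂ³`. -/
def cnorm3 (v : Fin 3 → ℂ) : ℝ := Real.sqrt (∑ j : Fin 3, Complex.normSq (v j))

/-- Pairing of a real vector with a complex vector. -/
def dotRC (v : E3) (w : Fin 3 → ℂ) : ℂ := ∑ j : Fin 3, (v j : ℂ) * w j

/-- A smooth cut-off `χ` which is `1` on `B_1(0)` and vanishes outside `B_2(0)`. -/
def IsCutoff (χ : E3 → ℝ) : Prop :=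
  ContDiff ℝ ((⊤ : ℕ∞) : WithTop ℕ∞) χ ∧ (∀ x : E3, ‖x‖ ≤ 1 → χ x = 1) ∧ (∀ x : E3, 2 ≤ ‖x‖ → χ x = 0)

/-- Kernel of the regularized Biot–Savart operator: `∇_y (χ(ℓ(x−y))/|x−y|)`. -/
def BSker (χ : E3 → ℝ) (ℓ : ℝ) (x y : E3) : E3 :=
  gradient (fun z => χ (ℓ • (x - z)) / ‖x - z‖) y

/-- Regularized Biot–Savart operator `BS_ℓ`. -/
def BSreg (χ : E3 → ℝ) (ℓ : ℝ) (ω : E3 → E3) (x : E3) : E3 :=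
  (4 * Real.pi)⁻¹ • ∫ y : E3, cross3 (ω y) (BSker χ ℓ x y)

/-- Regularized Biot–Savart operator on `ℂ³`-valued fields (componentwise). -/
def BSregC (χ : E3 → ℝ) (ℓ : ℝ) (ω : E3 → Fin 3 → ℂ) (x : E3) : Fin 3 → ℂ :=
  (4 * Real.pi)⁻¹ • ∫ y : E3, ccross3 (ω y) (toC3 (BSker χ ℓ x y))

/-- The discretized vorticity operator `Ω_k = (iν/γ) ∇_{C_{k+1}} × ∇_{C_k}`. -/
def vortOp [NeZero N] (γ ν : ℝ) (k : Fin N) (F : (Fin N → E3) → ℂ) (C : Fin N → E3) :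
    Fin 3 → ℂ :=
  (Complex.I * ν / γ) • opCross (k + 1) k F C

/-- The discretized diffusion operator `𝒟_k = 2 ∇_{C_k} × Ω_k`. -/
def diffOp [NeZero N] (γ ν : ℝ) (k : Fin N) (F : (Fin N → E3) → ℂ) (C : Fin N → E3) :
    Fin 3 → ℂ :=
  (2:ℂ) • vcurl k (vortOp γ ν k F) C

/-- The discretized velocity operator `U_k = (1/log(1/ρ)) BS_ℓ ∘ Ω_k`,
with `BS_ℓ` acting in the variable `C_k`. -/
def velOp [NeZero N] (χ : E3 → ℝ) (ℓ ρ γ ν : ℝ) (k : Fin N) (F : (Fin N → E3) → ℂ)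
    (C : Fin N → E3) : Fin 3 → ℂ :=
  (Real.log (1 / ρ))⁻¹ • BSregC χ ℓ (fun x => vortOp γ ν k F (Function.update C k x)) (C k)

/-- Levi-Civita symbol on `Fin 3`. -/
def levi3 (a b c : Fin 3) : ℝ :=
  if (a, b, c) = (0, 1, 2) ∨ (a, b, c) = (1, 2, 0) ∨ (a, b, c) = (2, 0, 1) then 1
  else if (a, b, c) = (2, 1, 0) ∨ (a, b, c) = (1, 0, 2) ∨ (a, b, c) = (0, 2, 1) then -1
  else 0

/-- The discretized advection operator `(Ω_{k+3} × U_k)_α = ε_{αij} Ω^i_{k+3} ∘ U^j_k`. -/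
def advecOp [NeZero N] (χ : E3 → ℝ) (ℓ ρ γ ν : ℝ) (k : Fin N) (F : (Fin N → E3) → ℂ)
    (C : Fin N → E3) : Fin 3 → ℂ :=
  fun α => ∑ i : Fin 3, ∑ j : Fin 3,
    (levi3 α i j : ℂ) * vortOp γ ν (k + 3) (fun D => velOp χ ℓ ρ γ ν k F D j) C i

/-- Migdal's discretized vorticity operator
`Ω^M_k = (iν/γ)(∑_{j=k+1}^{N-1} ∇_{C_j} + ½∇_{C_k}) × ∇_{C_k}`. -/
def vortOpM [NeZero N] (γ ν : ℝ) (k : Fin N) (F : (Fin N → E3) → ℂ) (C : Fin N → E3) :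
    Fin 3 → ℂ :=
  (Complex.I * ν / γ) •
    ((∑ j ∈ Finset.univ.filter (fun j : Fin N => (k : ℕ) < (j : ℕ)), opCross j k F C)
      + (2:ℂ)⁻¹ • opCross k k F C)

/-- Migdal's discretized diffusion operator `𝒟^M_k = 2 ∇_{C_k} × Ω^M_k`. -/
def diffOpM [NeZero N] (γ ν : ℝ) (k : Fin N) (F : (Fin N → E3) → ℂ) (C : Fin N → E3) :
    Fin 3 → ℂ :=
  (2:ℂ) • vcurl k (vortOpM γ ν k F) C

/-- Migdal's discretized velocity operator `U^M_k = (1/log(1/ρ)) BS_ℓ ∘ Ω^M_k`. -/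
def velOpM [NeZero N] (χ : E3 → ℝ) (ℓ ρ γ ν : ℝ) (k : Fin N) (F : (Fin N → E3) → ℂ)
    (C : Fin N → E3) : Fin 3 → ℂ :=
  (Real.log (1 / ρ))⁻¹ • BSregC χ ℓ (fun x => vortOpM γ ν k F (Function.update C k x)) (C k)

/-- The loop functional `Ψ[u,C] = exp((iγ/ν) Γ[u,C])` as a function of the vertices. -/
def loopExp (γ ν : ℝ) (N : ℕ) [NeZero N] (u : E3 → E3) (C : Fin N → E3) : ℂ :=
  Complex.exp (Complex.I * γ / ν * (circulation N u C : ℂ))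

/-- The momentum loop functional `Ψ[P,C](t) = exp((iγ/ν) ∑_k P_k(t)·ΔC_k)`. -/
def momFun (γ ν : ℝ) (N : ℕ) [NeZero N] (P : Fin N → ℝ → Fin 3 → ℂ) (t : ℝ)
    (C : Fin N → E3) : ℂ :=
  Complex.exp (Complex.I * γ / ν * ∑ k : Fin N, cdot (P k t) (toC3 (C (k + 1) - C k)))

/-- The expression `E_k` of the discretized momentum loop equation, as a function of
`ΔP_{k-1}, ΔP_k, ΔP_{k+2}, ΔP_{k+3}` (and of `log N`). -/
def EkDef (γ ν NR : ℝ) (dPm dP dP2 dP3 : Fin 3 → ℂ) : Fin 3 → ℂ :=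
  ((Real.log NR)⁻¹ : ℂ) •
      ((Complex.I * γ / ν) •
        ccross3 (ccross3 dP3 dP2) (dP - (cdot dPm dP / cdot dPm dPm) • dPm))
    + ((2 * γ ^ 2 / ν : ℝ) : ℂ) • (cdot dPm dPm • dP - cdot dPm dP • dPm)


section CirculationGradient

open Filter Topology

/-- The cross product as a continuous bilinear map. -/
def crossCLM : E3 →L[ℝ] E3 →L[ℝ] E3 :=
  (LinearMap.mk₂ ℝ cross3
    (fun v v' w => by ext i; fin_cases i <;> simp [cross3, vec3] <;> ring)
    (fun c v w => by ext i; fin_cases i <;> simp [cross3, vec3] <;> ring)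
    (fun v w w' => by ext i; fin_cases i <;> simp [cross3, vec3] <;> ring)
    (fun c v w => by ext i; fin_cases i <;> simp [cross3, vec3] <;> ring)).toContinuousBilinearMap

lemma crossCLM_apply (v w : E3) : crossCLM v w = cross3 v w := rfl

/-- The curl as a continuous linear function of the Jacobian. -/
def curlCLM : (E3 →L[ℝ] E3) →L[ℝ] E3 :=
  LinearMap.toContinuousLinearMap
    { toFun := fun A => vec3 (A (e3 1) 2 - A (e3 2) 1) (A (e3 2) 0 - A (e3 0) 2)
        (A (e3 0) 1 - A (e3 1) 0)
      map_add' := fun A B => by ext i; fin_cases i <;> simp [vec3] <;> ring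
      map_smul' := fun c A => by ext i; fin_cases i <;> simp [vec3] <;> ring }

lemma curl3_eq_curlCLM (u : E3 → E3) : curl3 u = fun x => curlCLM (fderiv ℝ u x) := rfl

lemma inner_cross_curlCLM (A : E3 →L[ℝ] E3) (w h : E3) :
    ⟪crossCLM (curlCLM A) w, h⟫ = ⟪A w, h⟫ - ⟪A h, w⟫ := by
  have key : ∀ v : E3, A v = v 0 • A (e3 0) + v 1 • A (e3 1) + v 2 • A (e3 2) := by
    intro v
    have hv : v = v 0 • e3 0 + v 1 • e3 1 + v 2 • e3 2 := by
      ext i; fin_cases i <;> simp [e3]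
    conv_lhs => rw [hv]
    simp
  rw [key w, key h, crossCLM_apply]
  simp only [curlCLM, cross3, vec3, LinearMap.coe_toContinuousLinearMap', LinearMap.coe_mk,
    AddHom.coe_mk, PiLp.inner_apply, Fin.sum_univ_three]
  simp
  ring

section Parametric

variable {V : Type} [NormedAddCommGroup V] [NormedSpace ℝ V]

lemma hasFDerivAt_intervalIntegral_of_contDiff {F : ℝ → E3 → V}
    (hF : ContDiff ℝ 1 (Function.uncurry F)) (x : E3) :
    HasFDerivAt (fun y => ∫ a in (0:ℝ)..1, F a y) (∫ a in (0:ℝ)..1, fderiv ℝ (F a) x) x := by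
  have hd : Continuous (fun z : ℝ × E3 => fderiv ℝ (F z.1) z.2) := by
    have : ContDiff ℝ 0 (fun z : ℝ × E3 => fderiv ℝ (F z.1) z.2) := by
      refine ContDiff.fderiv (f := fun z : ℝ × E3 => F z.1) (m := 1) ?_ contDiff_snd (by simp)
      exact hF.comp ((contDiff_fst.comp contDiff_fst).prodMk contDiff_snd)
    exact this.continuous
  obtain ⟨M, hM⟩ := ((isCompact_Icc (a := (0:ℝ)) (b := 1)).prod
    (isCompact_closedBall x 1)).exists_bound_of_continuousOn hd.continuousOn
  have hc : ∀ y, Continuous fun a => F a y := fun y =>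
    hF.continuous.comp (continuous_id.prodMk continuous_const)
  refine intervalIntegral.hasFDerivAt_integral_of_dominated_of_fderiv_le
    (F := fun y a => F a y) (F' := fun y a => fderiv ℝ (F a) y) (bound := fun _ => M)
    (Metric.closedBall_mem_nhds x one_pos) ?_ ?_ ?_ ?_ ?_ ?_
  · exact Eventually.of_forall fun y => (hc y).aestronglyMeasurable
  · exact (hc x).intervalIntegrable _ _
  · exact (hd.comp (continuous_id.prodMk continuous_const)).aestronglyMeasurable
  · refine Eventually.of_forall fun a ha y hy => hM (a, y) ⟨?_, hy⟩
    rw [Set.uIoc_of_le zero_le_one] at ha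
    exact Set.Ioc_subset_Icc_self ha
  · exact intervalIntegrable_const
  · refine Eventually.of_forall fun a _ y _ => ?_
    have : ContDiff ℝ 1 (F a) := hF.comp (contDiff_const.prodMk contDiff_id)
    exact (this.differentiable one_ne_zero y).hasFDerivAt

end Parametric

lemma norm_iteratedFDeriv_intervalIntegral_le (n : ℕ) :
    ∀ {V : Type} [NormedAddCommGroup V] [NormedSpace ℝ V] {F : ℝ → E3 → V},
    ContDiff ℝ n (Function.uncurry F) → ∀ {x : E3} {M : ℝ},
    (∀ a ∈ Set.Icc (0:ℝ) 1, ‖iteratedFDeriv ℝ n (F a) x‖ ≤ M) →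
    ‖iteratedFDeriv ℝ n (fun y => ∫ a in (0:ℝ)..1, F a y) x‖ ≤ M := by
  have base : ∀ {V : Type} [NormedAddCommGroup V] [NormedSpace ℝ V] {f : ℝ → V} {M : ℝ},
      (∀ a ∈ Set.Icc (0:ℝ) 1, ‖f a‖ ≤ M) → ‖∫ a in (0:ℝ)..1, f a‖ ≤ M := by
    intro V _ _ f M h
    refine (intervalIntegral.norm_integral_le_of_norm_le_const (C := M) ?_).trans (by simp)
    intro a ha
    rw [Set.uIoc_of_le zero_le_one] at ha
    exact h a (Set.Ioc_subset_Icc_self ha)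
  induction n with
  | zero =>
    intro V _ _ F _ x M h
    rw [norm_iteratedFDeriv_zero]
    exact base fun a ha => by simpa using h a ha
  | succ n ih =>
    intro V _ _ F hF x M h
    rw [← norm_iteratedFDeriv_fderiv]
    have h1 : ContDiff ℝ 1 (Function.uncurry F) := hF.of_le (by norm_cast; omega)
    have : fderiv ℝ (fun y => ∫ a in (0:ℝ)..1, F a y) =
        fun y => ∫ a in (0:ℝ)..1, fderiv ℝ (F a) y :=
      funext fun y => (hasFDerivAt_intervalIntegral_of_contDiff h1 y).fderiv
    rw [this]
    refine ih (F := fun a => fderiv ℝ (F a)) ?_ fun a ha => ?_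
    · refine ContDiff.fderiv (f := fun z : ℝ × E3 => F z.1) (m := (n + 1 : ℕ)) ?_ contDiff_snd
        (by norm_cast)
      exact hF.comp ((contDiff_fst.comp contDiff_fst).prodMk contDiff_snd)
    · rw [norm_iteratedFDeriv_fderiv]
      exact h a ha

/-- Line integral of `u` along the oriented segment from `p` to `x`. -/
def segCirc (u : E3 → E3) (p x : E3) : ℝ :=
  ∫ a in (0:ℝ)..1, ⟪u ((1 - a) • p + a • x), x - p⟫

/-- First moment of `ω × (x - p)` along the segment from `p` to `x`. -/
def segMoment (ω : E3 → E3) (p x : E3) : E3 :=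
  ∫ a in (0:ℝ)..1, a • crossCLM (ω ((1 - a) • p + a • x)) (x - p)

lemma segCirc_swap (u : E3 → E3) (p x : E3) : segCirc u p x = -segCirc u x p := by
  unfold segCirc
  rw [← intervalIntegral.integral_neg]
  have := intervalIntegral.integral_comp_sub_left (a := 0) (b := 1)
    (fun a : ℝ => -⟪u ((1 - a) • x + a • p), p - x⟫) (1:ℝ)
  simp only [sub_self, sub_zero] at this
  rw [← this]
  refine intervalIntegral.integral_congr fun a _ => ?_
  simp only [sub_sub_cancel]
  rw [← inner_neg_right, neg_sub, add_comm]

lemma hasGradientAt_segCirc {u : E3 → E3} (hu : ContDiff ℝ 1 u) (p x : E3) :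
    HasGradientAt (segCirc u p) (u x - segMoment (curl3 u) p x) x := by
  have hF : ContDiff ℝ 1 (Function.uncurry fun (a : ℝ) (y : E3) =>
      ⟪u ((1 - a) • p + a • y), y - p⟫) := by
    unfold Function.uncurry
    exact ContDiff.inner ℝ (by fun_prop) (by fun_prop)
  have hmain := hasFDerivAt_intervalIntegral_of_contDiff hF x
  have hdu : Continuous (fderiv ℝ u) := hu.continuous_fderiv one_ne_zero
  have hline : ∀ a : ℝ, HasDerivAt (fun a : ℝ => (1 - a) • p + a • x) (x - p) a := by
    intro a
    have := (((hasDerivAt_id a).const_sub 1).smul_const p).add ((hasDerivAt_id a).smul_const x)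
    refine this.congr_deriv ?_
    rw [neg_one_smul, one_smul, sub_eq_neg_add]
  have hcross : Continuous fun a : ℝ =>
      a • crossCLM (curl3 u ((1 - a) • p + a • x)) (x - p) := by
    rw [curl3_eq_curlCLM]
    fun_prop
  have hfd : ∀ (a : ℝ) (h : E3),
      fderiv ℝ (fun y => ⟪u ((1 - a) • p + a • y), y - p⟫) x h =
        (⟪u ((1 - a) • p + a • x), h⟫
            + a * ⟪fderiv ℝ u ((1 - a) • p + a • x) (x - p), h⟫)
          - ⟪h, a • crossCLM (curl3 u ((1 - a) • p + a • x)) (x - p)⟫ := by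
    intro a h
    have h1 : HasFDerivAt (fun y : E3 => (1 - a) • p + a • y)
        (a • ContinuousLinearMap.id ℝ E3) x :=
      ((hasFDerivAt_id x).const_smul a).const_add _
    have h2 := ((hu.differentiable one_ne_zero ((1 - a) • p + a • x)).hasFDerivAt).comp x h1
    have h3 := HasFDerivAt.inner ℝ h2 ((hasFDerivAt_id x).sub_const p)
    have h4 := congrArg (fun L : E3 →L[ℝ] ℝ => L h) h3.fderiv
    refine Eq.trans h4 ?_
    have h5 := inner_cross_curlCLM (fderiv ℝ u ((1 - a) • p + a • x)) (x - p) h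
    rw [inner_smul_right, real_inner_comm _ h, curl3_eq_curlCLM, h5]
    simp [inner_smul_left]
    ring
  have hcF : Continuous fun a : ℝ => fderiv ℝ (fun y => ⟪u ((1 - a) • p + a • y), y - p⟫) x := by
    have : ContDiff ℝ 0 fun a : ℝ =>
        fderiv ℝ (fun y => ⟪u ((1 - a) • p + a • y), y - p⟫) x :=
      ContDiff.fderiv (m := 1) hF contDiff_const (by simp)
    exact this.continuous
  rw [hasGradientAt_iff_hasFDerivAt]
  refine hmain.congr_fderiv (Eq.symm (ContinuousLinearMap.ext fun h => ?_))
  rw [ContinuousLinearMap.intervalIntegral_apply (hcF.intervalIntegrable _ _)]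
  simp only [hfd, InnerProductSpace.toDual_apply_apply]
  have hc1 : Continuous fun a : ℝ => ⟪u ((1 - a) • p + a • x), h⟫
      + a * ⟪fderiv ℝ u ((1 - a) • p + a • x) (x - p), h⟫ := by
    have := hu.continuous
    fun_prop
  have hc2 : Continuous fun a : ℝ =>
      ⟪h, a • crossCLM (curl3 u ((1 - a) • p + a • x)) (x - p)⟫ := by fun_prop
  rw [intervalIntegral.integral_sub (hc1.intervalIntegrable _ _) (hc2.intervalIntegrable _ _),
    inner_sub_left]
  congr 1
  · rw [intervalIntegral.integral_eq_sub_of_hasDerivAt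
      (f := fun a : ℝ => a * ⟪u ((1 - a) • p + a • x), h⟫) ?_ (hc1.intervalIntegrable _ _)]
    · simp
    · intro a _
      have h2 := ((hu.differentiable one_ne_zero
        ((1 - a) • p + a • x)).hasFDerivAt).comp_hasDerivAt a (hline a)
      have h3 := (hasDerivAt_id a).mul (HasDerivAt.inner ℝ h2 (hasDerivAt_const a h))
      refine h3.congr_deriv ?_
      simp
  · rw [real_inner_comm]
    exact ((innerSL ℝ h).intervalIntegral_comp_comm (hcross.intervalIntegrable 0 1)).symm

lemma fin_ne_add_one [NeZero N] (hN : 3 ≤ N) (k : Fin N) : k + 1 ≠ k := by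
  intro h
  have h1 : (1 : Fin N) = 0 := by simpa using h
  have := congrArg Fin.val h1
  rw [Fin.val_one', Nat.mod_eq_of_lt (by omega)] at this
  simp at this

lemma fin_sub_one_ne [NeZero N] (hN : 3 ≤ N) (k : Fin N) : k - 1 ≠ k := by
  intro h
  exact fin_ne_add_one hN (k - 1) (by simpa using h.symm)

lemma fin_add_one_ne_sub_one [NeZero N] (hN : 3 ≤ N) (k : Fin N) : k + 1 ≠ k - 1 := by
  intro h
  have h1 : (1 : Fin N) + 1 = 0 := by
    have := congrArg (fun x => x + 1 - k) h
    simpa [add_assoc] using this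
  have := congrArg Fin.val h1
  rw [Fin.val_add, Fin.val_one', Nat.mod_eq_of_lt (a := 1) (by omega),
    Nat.mod_eq_of_lt (by omega)] at this
  simp at this

/-- The gradient of the circulation in the vertex `C_k` involves only the vorticity. -/
lemma vgradR_circulation [NeZero N] (hN : 3 ≤ N) {u : E3 → E3} (hu : ContDiff ℝ 1 u)
    (C : Fin N → E3) (k : Fin N) :
    vgradR k (circulation N u) C =
      segMoment (curl3 u) (C (k + 1)) (C k) - segMoment (curl3 u) (C (k - 1)) (C k) := by
  have hsplit : ∀ x, circulation N u (Function.update C k x) =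
      segCirc u (C (k - 1)) x - segCirc u (C (k + 1)) x +
        ∑ i ∈ (Finset.univ.erase k).erase (k - 1), segCirc u (C i) (C (i + 1)) := by
    intro x
    have hmem : k - 1 ∈ Finset.univ.erase k := by simp [fin_sub_one_ne hN k]
    change ∑ i, segCirc u (Function.update C k x i) (Function.update C k x (i + 1)) = _
    rw [← Finset.add_sum_erase _ _ (Finset.mem_univ k), ← Finset.add_sum_erase _ _ hmem,
      sub_add_cancel, Function.update_self, Function.update_of_ne (fin_ne_add_one hN k),
      Function.update_of_ne (fin_sub_one_ne hN k), segCirc_swap u x, ← add_assoc]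
    congr 1
    · ring
    · refine Finset.sum_congr rfl fun i hi => ?_
      simp only [Finset.mem_erase, Finset.mem_univ, and_true] at hi
      rw [Function.update_of_ne hi.2, Function.update_of_ne]
      intro h
      exact hi.1 (by rw [← h]; simp)
  unfold vgradR
  rw [funext hsplit]
  have h1 := hasGradientAt_segCirc hu (C (k - 1)) (C k)
  have h2 := hasGradientAt_segCirc hu (C (k + 1)) (C k)
  rw [hasGradientAt_iff_hasFDerivAt] at h1 h2
  refine HasGradientAt.gradient ?_
  rw [hasGradientAt_iff_hasFDerivAt]
  refine ((h1.sub h2).add_const _).congr_fderiv ?_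
  rw [← map_sub]
  congr 1
  abel

lemma le_cNorm {m j : ℕ} (hj : j ≤ m) {ω : E3 → E3}
    (hω : ∃ M, ∀ x, ‖iteratedFDeriv ℝ j ω x‖ ≤ M) (x : E3) :
    ‖iteratedFDeriv ℝ j ω x‖ ≤ cNorm m ω := by
  obtain ⟨M, hM⟩ := hω
  have h1 : ‖iteratedFDeriv ℝ j ω x‖ ≤ supDeriv j ω :=
    le_ciSup (f := fun x => ‖iteratedFDeriv ℝ j ω x‖) ⟨M, by rintro _ ⟨y, rfl⟩; exact hM y⟩ x
  exact h1.trans (Finset.le_sup' (fun j => supDeriv j ω) (Finset.mem_range.mpr (by omega)))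

lemma contDiff_curl3 {m : ℕ} {u : E3 → E3} (hu : ContDiff ℝ (m + 1 : ℕ) u) :
    ContDiff ℝ m (curl3 u) :=
  curlCLM.contDiff.comp (hu.fderiv_right (by norm_cast))

lemma exists_bound_iteratedFDeriv_curl3 {m j : ℕ} (hj : j ≤ m) {u : E3 → E3}
    (hu : ContDiff ℝ (m + 1 : ℕ) u)
    (hb : ∃ M, ∀ x, ‖iteratedFDeriv ℝ (j + 1) u x‖ ≤ M) :
    ∃ M, ∀ x, ‖iteratedFDeriv ℝ j (curl3 u) x‖ ≤ M := by
  obtain ⟨M, hM⟩ := hb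
  refine ⟨‖curlCLM‖ * M, fun x => ?_⟩
  have h1 : ContDiff ℝ m (fderiv ℝ u) := hu.fderiv_right (by norm_cast)
  refine (curlCLM.norm_iteratedFDeriv_comp_left (N := m) h1.contDiffAt
    (by exact_mod_cast hj)).trans ?_
  rw [norm_iteratedFDeriv_fderiv]
  exact mul_le_mul_of_nonneg_left (hM x) (norm_nonneg _)

lemma norm_iteratedFDeriv_comp_smul_le {i : ℕ} {g : E3 → E3} (hg : ContDiff ℝ i g) {s : ℝ}
    (hs : |s| ≤ 1) (x : E3) :
    ‖iteratedFDeriv ℝ i (fun y => g (s • y)) x‖ ≤ ‖iteratedFDeriv ℝ i g (s • x)‖ := by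
  rw [iteratedFDeriv_comp_const_smul s hg]
  simp only [norm_smul, norm_pow, Real.norm_eq_abs]
  exact mul_le_of_le_one_left (norm_nonneg _) (pow_le_one₀ (abs_nonneg s) hs)

lemma norm_iteratedFDeriv_comp_affine_le {i : ℕ} {ω : E3 → E3} (hω : ContDiff ℝ i ω) {W : ℝ}
    (hW : ∀ x, ‖iteratedFDeriv ℝ i ω x‖ ≤ W) {s : ℝ} (hs : |s| ≤ 1) (b x : E3) :
    ‖iteratedFDeriv ℝ i (fun y => ω (s • y + b)) x‖ ≤ W := by
  refine (norm_iteratedFDeriv_comp_smul_le (g := fun y => ω (y + b)) (by fun_prop) hs x).trans ?_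
  rw [iteratedFDeriv_comp_add_right]
  exact hW _

lemma norm_iteratedFDeriv_comp_affine_sub_le {i : ℕ} {ω : E3 → E3}
    (hω : ContDiff ℝ (i + 1 : ℕ) ω) {W : ℝ} (hW : ∀ x, ‖iteratedFDeriv ℝ (i + 1) ω x‖ ≤ W)
    {s : ℝ} (hs : |s| ≤ 1) (b b' x : E3) :
    ‖iteratedFDeriv ℝ i (fun y => ω (s • y + b) - ω (s • y + b')) x‖ ≤ W * ‖b - b'‖ := by
  have hi : ContDiff ℝ i ω := hω.of_le (by norm_cast; omega)
  refine (norm_iteratedFDeriv_comp_smul_le (g := fun y => ω (y + b) - ω (y + b'))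
    (by fun_prop) hs x).trans ?_
  have h1 : ContDiff ℝ i (fun y => ω (y + b)) := by fun_prop
  have h2 : ContDiff ℝ i (fun y => ω (y + b')) := by fun_prop
  rw [fun_iteratedFDeriv_sub_apply h1.contDiffAt h2.contDiffAt, iteratedFDeriv_comp_add_right,
    iteratedFDeriv_comp_add_right]
  have hd : Differentiable ℝ (iteratedFDeriv ℝ i ω) :=
    hω.differentiable_iteratedFDeriv (by norm_cast; omega)
  have := convex_univ.norm_image_sub_le_of_norm_fderiv_le (𝕜 := ℝ) (C := W)
    (f := iteratedFDeriv ℝ i ω) (x := s • x + b') (y := s • x + b) (fun y _ => hd y)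
    (fun y _ => by rw [norm_fderiv_iteratedFDeriv]; exact hW y) trivial trivial
  simpa using this

lemma norm_iteratedFDeriv_le_of_fderiv_eq_const {g : E3 → E3} {L : E3 →L[ℝ] E3}
    (hg : fderiv ℝ g = fun _ => L) (hL : ‖L‖ ≤ 1) (j : ℕ) (x : E3) :
    ‖iteratedFDeriv ℝ j g x‖ ≤ 1 + ‖g x‖ := by
  rcases j with _ | _ | j
  · simp
  · rw [← norm_iteratedFDeriv_fderiv, hg, norm_iteratedFDeriv_zero]
    exact hL.trans (le_add_of_nonneg_right (norm_nonneg _))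
  · rw [← norm_iteratedFDeriv_fderiv, hg, iteratedFDeriv_const_of_ne (Nat.succ_ne_zero j)]
    simp only [Pi.zero_apply, norm_zero]
    positivity

lemma norm_iteratedFDeriv_cross_le {n : ℕ} {f g : E3 → E3} (hf : ContDiff ℝ n f)
    (hg : ContDiff ℝ n g) {L : E3 →L[ℝ] E3} (hgL : fderiv ℝ g = fun _ => L) (hL : ‖L‖ ≤ 1)
    {A : ℝ} (x : E3) (hA : ∀ i ≤ n, ‖iteratedFDeriv ℝ i f x‖ ≤ A) :
    ‖iteratedFDeriv ℝ n (fun y => crossCLM (f y) (g y)) x‖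
      ≤ 2 ^ n * ‖crossCLM‖ * A * (1 + ‖g x‖) := by
  have hA0 : 0 ≤ A := (norm_nonneg _).trans (hA 0 (Nat.zero_le n))
  refine (crossCLM.norm_iteratedFDeriv_le_of_bilinear hf hg x le_rfl).trans ?_
  have : ∑ i ∈ Finset.range (n + 1), (n.choose i : ℝ) * ‖iteratedFDeriv ℝ i f x‖ *
      ‖iteratedFDeriv ℝ (n - i) g x‖
      ≤ ∑ i ∈ Finset.range (n + 1), (n.choose i : ℝ) * (A * (1 + ‖g x‖)) := by
    refine Finset.sum_le_sum fun i hi => ?_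
    rw [mul_assoc]
    gcongr
    · exact hA i (by simpa [Nat.lt_succ_iff] using hi)
    · exact norm_iteratedFDeriv_le_of_fderiv_eq_const hgL hL _ x
  rw [← Finset.sum_mul, ← Nat.cast_sum, Nat.sum_range_choose] at this
  calc _ ≤ ‖crossCLM‖ * (((2 ^ n : ℕ) : ℝ) * (A * (1 + ‖g x‖))) := by gcongr
    _ = _ := by push_cast; ring

lemma norm_iteratedFDeriv_unit_smul_le {n : ℕ} {f : E3 → E3} (hf : ContDiff ℝ n f) {a : ℝ}
    (ha : a ∈ Set.Icc (0:ℝ) 1) (x : E3) :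
    ‖iteratedFDeriv ℝ n (fun y => a • f y) x‖ ≤ ‖iteratedFDeriv ℝ n f x‖ := by
  rw [iteratedFDeriv_const_smul_apply' hf.contDiffAt, norm_smul, Real.norm_of_nonneg ha.1]
  exact mul_le_of_le_one_left (norm_nonneg _) ha.2

lemma norm_iteratedFDeriv_segMoment_sub_le {K : ℕ} {ω : E3 → E3}
    (hω : ContDiff ℝ (K + 1 : ℕ) ω) {W : ℝ}
    (hW : ∀ j ≤ K + 1, ∀ x, ‖iteratedFDeriv ℝ j ω x‖ ≤ W) (p q x : E3) :
    ‖iteratedFDeriv ℝ K (fun y => segMoment ω q y - segMoment ω p y) x‖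
      ≤ (2 ^ K + 1) * ‖crossCLM‖ * ‖q - p‖ * (1 + ‖x - p‖) * W := by
  have hωK : ContDiff ℝ K ω := hω.of_le (by norm_cast; omega)
  have hW0 : 0 ≤ W := (norm_nonneg _).trans (hW 0 (Nat.zero_le _) 0)
  have hcont : ∀ p y, Continuous fun a : ℝ =>
      a • crossCLM (ω ((1 - a) • p + a • y)) (y - p) := fun p y => by
    have := hω.continuous
    fun_prop
  have hrw : (fun y => segMoment ω q y - segMoment ω p y) = fun y => ∫ a in (0:ℝ)..1,
      a • (crossCLM (ω (a • y + (1 - a) • q) - ω (a • y + (1 - a) • p)) (y - p)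
        - crossCLM (ω (a • y + (1 - a) • q)) (q - p)) := by
    funext y
    unfold segMoment
    rw [← intervalIntegral.integral_sub ((hcont q y).intervalIntegrable _ _)
      ((hcont p y).intervalIntegrable _ _)]
    refine intervalIntegral.integral_congr fun a _ => ?_
    have : y - q = (y - p) - (q - p) := by abel
    simp only [this, map_sub, sub_apply, add_comm (a • y), smul_sub]
    abel
  rw [hrw]
  refine norm_iteratedFDeriv_intervalIntegral_le K ?_ fun a ha => ?_
  · unfold Function.uncurry
    fun_prop
  have ha1 : |a| ≤ 1 := abs_le.mpr ⟨by linarith [ha.1], ha.2⟩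
  have hsmall : ‖(1 - a) • q - (1 - a) • p‖ ≤ ‖q - p‖ := by
    rw [← smul_sub, norm_smul, Real.norm_of_nonneg (by linarith [ha.2])]
    exact mul_le_of_le_one_left (norm_nonneg _) (by linarith [ha.1])
  have hq : ContDiff ℝ K fun y => ω (a • y + (1 - a) • q) := by fun_prop
  have hp : ContDiff ℝ K fun y => ω (a • y + (1 - a) • p) := by fun_prop
  have h1 : ContDiff ℝ K fun y =>
      crossCLM (ω (a • y + (1 - a) • q) - ω (a • y + (1 - a) • p)) (y - p) := by fun_prop
  have h2 : ContDiff ℝ K fun y => crossCLM (ω (a • y + (1 - a) • q)) (q - p) := by fun_prop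
  refine (norm_iteratedFDeriv_unit_smul_le (h1.sub h2) ha x).trans ?_
  rw [fun_iteratedFDeriv_sub_apply h1.contDiffAt h2.contDiffAt]
  have b1 := norm_iteratedFDeriv_cross_le (hq.sub hp) (contDiff_id.sub contDiff_const)
    (g := fun y => y - p) (L := ContinuousLinearMap.id ℝ E3)
    (funext fun y => ((hasFDerivAt_id y).sub_const p).fderiv) ContinuousLinearMap.norm_id_le x
    (A := W * ‖q - p‖) fun i hi =>
      (norm_iteratedFDeriv_comp_affine_sub_le (hω.of_le (by norm_cast; omega))
        (hW (i + 1) (by omega)) ha1 _ _ x).trans (mul_le_mul_of_nonneg_left hsmall hW0)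
  have b2 : ‖iteratedFDeriv ℝ K (fun y => crossCLM (ω (a • y + (1 - a) • q)) (q - p)) x‖
      ≤ ‖crossCLM‖ * ‖q - p‖ * W := by
    refine ((crossCLM.flip (q - p)).norm_iteratedFDeriv_comp_left hq.contDiffAt le_rfl).trans ?_
    gcongr
    · exact (crossCLM.flip.le_opNorm _).trans_eq (by rw [ContinuousLinearMap.opNorm_flip])
    · exact norm_iteratedFDeriv_comp_affine_le hωK (hW K (by omega)) ha1 _ x
  have b3 : ‖crossCLM‖ * ‖q - p‖ * W ≤ ‖crossCLM‖ * ‖q - p‖ * W * (1 + ‖x - p‖) :=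
    le_mul_of_one_le_right (by positivity) (le_add_of_nonneg_right (norm_nonneg _))
  refine (norm_sub_le _ _).trans ((add_le_add b1 (b2.trans b3)).trans_eq ?_)
  ring

lemma norm_fderiv_segMoment_start_le {ω : E3 → E3} (hω : ContDiff ℝ 1 ω) {W : ℝ}
    (hW : ∀ j ≤ 1, ∀ x, ‖iteratedFDeriv ℝ j ω x‖ ≤ W) (q x : E3) :
    ‖fderiv ℝ (fun p => segMoment ω p x) q‖ ≤ 2 * ‖crossCLM‖ * (1 + ‖x - q‖) * W := by
  have hω1 : ContDiff ℝ (1 : ℕ) ω := by exact_mod_cast hω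
  rw [← norm_iteratedFDeriv_one]
  unfold segMoment
  refine norm_iteratedFDeriv_intervalIntegral_le 1 ?_ fun a ha => ?_
  · unfold Function.uncurry
    fun_prop
  have hf : ContDiff ℝ (1 : ℕ) fun p => ω ((1 - a) • p + a • x) := by fun_prop
  have hg : ContDiff ℝ (1 : ℕ) fun p : E3 => x - p := by fun_prop
  refine (norm_iteratedFDeriv_unit_smul_le (f := fun p => crossCLM (ω ((1 - a) • p + a • x))
    (x - p)) (by fun_prop) ha q).trans ?_
  refine (norm_iteratedFDeriv_cross_le hf hg (L := -ContinuousLinearMap.id ℝ E3)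
    (funext fun y => ((hasFDerivAt_id y).const_sub x).fderiv)
    (by rw [norm_neg]; exact ContinuousLinearMap.norm_id_le) q (A := W) fun i hi =>
      norm_iteratedFDeriv_comp_affine_le (hω1.of_le (by exact_mod_cast hi)) (hW i hi)
        (abs_le.mpr ⟨by linarith [ha.2], by linarith [ha.1]⟩) _ q).trans_eq ?_
  ring

lemma one_add_norm_le_mul (p q x : E3) :
    1 + ‖x - q‖ ≤ (1 + ‖q - p‖) * (1 + ‖x - p‖) := by
  have : ‖x - q‖ ≤ ‖x - p‖ + ‖q - p‖ := by
    rw [← sub_sub_sub_cancel_right x q p]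
    exact norm_sub_le _ _
  nlinarith [norm_nonneg (q - p), norm_nonneg (x - p)]

end CirculationGradient

/-! ## Statement 1 -/
theorem stmt_1 :
    ∃ c > (0:ℝ), ∀ K : ℕ, ∃ cK > (0:ℝ),
      ∀ (N : ℕ) [NeZero N], 3 ≤ N →
      ∀ u : E3 → E3, ContDiff ℝ (K + 2 : ℕ) u →
      (∀ j ≤ K + 2, ∃ M, ∀ x, ‖iteratedFDeriv ℝ j u x‖ ≤ M) →
      ∀ (C : Fin N → E3) (k : Fin N),
        ‖iteratedFDeriv ℝ K (fun x => vgradR k (circulation N u) (Function.update C k x)) (C k)‖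
            ≤ cK * ‖C (k + 1) - C (k - 1)‖ * (1 + ‖C k - C (k - 1)‖) * cNorm (K + 1) (curl3 u) ∧
        ‖fderiv ℝ (fun x => vgradR k (circulation N u) (Function.update C (k + 1) x)) (C (k + 1))‖
            ≤ c * (1 + ‖C (k + 1) - C (k - 1)‖) * (1 + ‖C k - C (k - 1)‖) * cNorm 2 (curl3 u) ∧
        ‖fderiv ℝ (fun x => vgradR k (circulation N u) (Function.update C (k - 1) x)) (C (k - 1))‖
            ≤ c * (1 + ‖C (k + 1) - C (k - 1)‖) * (1 + ‖C (k + 1) - C k‖) * cNorm 2 (curl3 u) := by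
  refine ⟨2 * ‖crossCLM‖ + 1, by positivity, fun K =>
    ⟨(2 ^ K + 1) * ‖crossCLM‖ + 1, by positivity, ?_⟩⟩
  intro N _ hN u hu hb C k
  have hu1 : ContDiff ℝ 1 u := hu.of_le (by norm_cast; omega)
  have hω : ContDiff ℝ (K + 1 : ℕ) (curl3 u) := contDiff_curl3 hu
  have hω1 : ContDiff ℝ 1 (curl3 u) := hω.of_le (by norm_cast; omega)
  have hbω : ∀ j ≤ K + 1, ∃ M, ∀ x, ‖iteratedFDeriv ℝ j (curl3 u) x‖ ≤ M := fun j hj =>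
    exists_bound_iteratedFDeriv_curl3 hj hu (hb (j + 1) (by omega))
  have hWK : ∀ j ≤ K + 1, ∀ x, ‖iteratedFDeriv ℝ j (curl3 u) x‖ ≤ cNorm (K + 1) (curl3 u) :=
    fun j hj => le_cNorm hj (hbω j hj)
  have hW2 : ∀ j ≤ 1, ∀ x, ‖iteratedFDeriv ℝ j (curl3 u) x‖ ≤ cNorm 2 (curl3 u) :=
    fun j hj => le_cNorm (by omega) (hbω j (by omega))
  have hWK0 := (norm_nonneg _).trans (hWK 0 (Nat.zero_le _) 0)
  have hW20 := (norm_nonneg _).trans (hW2 0 (Nat.zero_le _) 0)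
  simp only [vgradR_circulation hN hu1, Function.update_self,
    Function.update_of_ne (fin_ne_add_one hN k), Function.update_of_ne (fin_sub_one_ne hN k),
    Function.update_of_ne (fin_ne_add_one hN k).symm,
    Function.update_of_ne (fin_sub_one_ne hN k).symm,
    Function.update_of_ne (fin_add_one_ne_sub_one hN k),
    Function.update_of_ne (fin_add_one_ne_sub_one hN k).symm]
  refine ⟨?_, ?_, ?_⟩
  · refine (norm_iteratedFDeriv_segMoment_sub_le hω hWK _ _ _).trans ?_
    gcongr
    linarith
  · rw [fderiv_sub_const]
    refine (norm_fderiv_segMoment_start_le hω1 hW2 _ _).trans ?_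
    rw [mul_assoc (2 * ‖crossCLM‖ + 1)]
    gcongr
    · linarith
    · exact one_add_norm_le_mul _ _ _
  · rw [fderiv_const_sub, norm_neg]
    refine (norm_fderiv_segMoment_start_le hω1 hW2 _ _).trans ?_
    rw [mul_assoc (2 * ‖crossCLM‖ + 1), norm_sub_rev (C (k + 1)) (C (k - 1)),
      norm_sub_rev (C (k + 1)) (C k)]
    gcongr
    · linarith
    · exact one_add_norm_le_mul _ _ _

end
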